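/- arXiv:2304.13220 — 4 statements merged into one kernel-verified Lean document; each statement's English description precedes it below -/
import Mathlib

section
/- Let f : ℝⁿ → ℝᵐ be differentiable and satisfy the local tangential cone condition with constant ξ < 1/2, and let x* ∈ ℝⁿ satisfy f(x*) = 0. Let x_k ∈ ℝⁿ, let τ_k ⊆ {1,…,m} be a nonempty index set, set η_k = Σ_{i∈τ_k} (−f_i(x_k)) e_i ∈ ℝᵐ, assume f'(x_k)ᵀ η_k ≠ 0, and define x_{k+1} = x_k − (η_kᵀ f(x_k) / ‖f'(x_k)ᵀ η_k‖₂²) · f'(x_k)ᵀ η_k. Then ‖x_{k+1} − x*‖₂² ≤ ‖x_k − x*‖₂² − (1 − 2ξ) · |η_kᵀ f(x_k)|² / ‖f'(x_k)ᵀ η_k‖₂². -/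
open Matrix

/-- Expansion of the squared distance after a step along `d`, when `s` and the inner product of
`d` with the error `x - y` satisfy `⟪d, x - y⟫ ≤ (1 - ξ) s` and `s ≤ 0`. -/
theorem sum_sq_sub_step_le {ι : Type*} [Fintype ι] (x y d : ι → ℝ) {s ξ : ℝ} (hd : d ≠ 0)
    (hs : s ≤ 0) (h : d ⬝ᵥ (x - y) ≤ (1 - ξ) * s) :
    ∑ j, ((x - (s / ∑ j, d j ^ 2) • d) j - y j) ^ 2
      ≤ ∑ j, (x j - y j) ^ 2 - (1 - 2 * ξ) * s ^ 2 / ∑ j, d j ^ 2 := by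
  have hD : 0 < ∑ j, d j ^ 2 := by
    obtain ⟨j, hj⟩ := Function.ne_iff.mp hd
    exact Finset.sum_pos' (fun i _ => sq_nonneg (d i))
      ⟨j, Finset.mem_univ j, sq_pos_of_ne_zero hj⟩
  set D := ∑ j, d j ^ 2 with hDdef
  have expand : ∑ j, ((x - (s / D) • d) j - y j) ^ 2
      = ∑ j, (x j - y j) ^ 2 - 2 * (s / D) * (d ⬝ᵥ (x - y)) + (s / D) ^ 2 * D := by
    rw [hDdef, dotProduct, Finset.mul_sum, Finset.mul_sum, ← Finset.sum_sub_distrib,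
      ← Finset.sum_add_distrib]
    refine Finset.sum_congr rfl fun j _ => ?_
    simp only [Pi.sub_apply, Pi.smul_apply, smul_eq_mul]
    ring
  have key : s / D * ((1 - ξ) * s) ≤ s / D * (d ⬝ᵥ (x - y)) :=
    mul_le_mul_of_nonpos_left h (div_nonpos_of_nonpos_of_nonneg hs hD.le)
  have e₁ : (s / D) ^ 2 * D = s / D * s := by field_simp
  have e₂ : (1 - 2 * ξ) * s ^ 2 / D = (1 - 2 * ξ) * (s / D * s) := by ring
  rw [expand, e₁, e₂]
  linarith

/-- A relative error bound `|a - b| ≤ ξ |a|` forces `a * b ≥ (1 - ξ) a ^ 2`. -/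
theorem one_sub_mul_sq_le_mul {a b ξ : ℝ} (h : |a - b| ≤ ξ * |a|) :
    (1 - ξ) * a ^ 2 ≤ a * b := by
  have h₁ : a * (a - b) ≤ |a| * (ξ * |a|) :=
    (le_abs_self _).trans (abs_mul a (a - b) ▸ mul_le_mul_of_nonneg_left h (abs_nonneg a))
  have h₂ : |a| * (ξ * |a|) = ξ * a ^ 2 := by rw [mul_left_comm, abs_mul_abs_self, sq]
  linarith [mul_sub a a b, sq a]

/-- one-step estimate for the average block nonlinear Kaczmarz update.
With `ηₖ = ∑_{i∈τₖ} (−fᵢ(xₖ)) eᵢ` and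
`x_{k+1} = xₖ − (ηₖᵀ f(xₖ)/‖f'(xₖ)ᵀηₖ‖₂²)·f'(xₖ)ᵀηₖ`, one has
`‖x_{k+1} − x*‖₂² ≤ ‖xₖ − x*‖₂² − (1 − 2ξ)·|ηₖᵀ f(xₖ)|²/‖f'(xₖ)ᵀηₖ‖₂²`. -/
theorem average_block_kaczmarz_one_step
    {n m : ℕ}
    (f : (Fin n → ℝ) → (Fin m → ℝ))
    (J : (Fin n → ℝ) → Matrix (Fin m) (Fin n) ℝ)
    (hJ : ∀ x, HasFDerivAt f (LinearMap.toContinuousLinearMap (J x).mulVecLin) x)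
    (ξ : ℝ) (hξ0 : 0 ≤ ξ) (hξ : ξ < 1 / 2)
    (htcc : ∀ (i : Fin m) (x₁ x₂ : Fin n → ℝ),
      |f x₁ i - f x₂ i - (J x₁).mulVec (x₁ - x₂) i| ≤ ξ * |f x₁ i - f x₂ i|)
    (xs : Fin n → ℝ) (hxs : f xs = 0)
    (xk : Fin n → ℝ)
    (τk : Finset (Fin m)) (hτk : τk.Nonempty)
    (ηk : Fin m → ℝ)
    (hη : ηk = fun i => if i ∈ τk then -(f xk i) else 0)
    (hATη : ((J xk)ᵀ).mulVec ηk ≠ 0)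
    (xk1 : Fin n → ℝ)
    (hupd : xk1 = xk -
      ((∑ i, ηk i * f xk i) / (∑ j, (((J xk)ᵀ).mulVec ηk j) ^ 2)) • ((J xk)ᵀ).mulVec ηk) :
    ∑ j, (xk1 j - xs j) ^ 2
      ≤ ∑ j, (xk j - xs j) ^ 2
        - (1 - 2 * ξ) * (∑ i, ηk i * f xk i) ^ 2 / ∑ j, (((J xk)ᵀ).mulVec ηk j) ^ 2 := by
  subst hupd
  refine sum_sq_sub_step_le xk xs _ hATη ?_ ?_
  · refine Finset.sum_nonpos fun i _ => ?_
    rw [hη]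
    dsimp only
    split_ifs
    · nlinarith [sq_nonneg (f xk i)]
    · simp
  · rw [Matrix.mulVec_transpose, ← Matrix.dotProduct_mulVec, dotProduct, Finset.mul_sum]
    refine Finset.sum_le_sum fun i _ => ?_
    have h := htcc i xk xs
    simp only [hxs, Pi.zero_apply, sub_zero] at h
    have h' := one_sub_mul_sq_le_mul h
    rw [hη]
    dsimp only
    split_ifs
    · linarith
    · simp
end

section
/- (Comparison of convergence factors of NGABK and NRK.) Let f : ℝⁿ → ℝᵐ be differentiable, let x_k ∈ ℝⁿ with f(x_k) ≠ 0 and f'(x_k) ≠ 0, let 0 < ξ < 1/2, and assume σ_min(f'(x_k)) > 0. Set δ_k = (1/2)·( max_{i∈[m]} |f_i(x_k)|² / ‖f(x_k)‖₂² + 1/m ) and τ_k = { i ∈ [m] : |f_i(x_k)|² ≥ δ_k ‖f(x_k)‖₂² } (which is nonempty). Then 1 − ((1−2ξ)/(1+ξ²)) · δ_k |τ_k| σ_min²(f'(x_k)) / ‖f'_{τ_k}(x_k)‖₂² < 1 − ((1−2ξ)/(1+ξ)²) · σ_min²(f'(x_k)) / ( m ‖f'(x_k)‖_F² ), i.e.,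 the NGABK convergence factor is strictly smaller than the NRK convergence factor. -/
open Matrix

lemma sum_sq_mulVec_transpose_submatrix_le {m n : ℕ} (A : Matrix (Fin m) (Fin n) ℝ)
    (τ : Finset (Fin m)) (w : {i // i ∈ τ} → ℝ) :
    ∑ j, (((A.submatrix (Subtype.val : {i // i ∈ τ} → Fin m) id)ᵀ).mulVec w j) ^ 2
      ≤ (∑ i, ∑ j, A i j ^ 2) * ∑ i, w i ^ 2 := by
  rw [Finset.sum_comm, Finset.sum_mul]
  refine Finset.sum_le_sum fun j _ => ?_
  calc (((A.submatrix (Subtype.val : {i // i ∈ τ} → Fin m) id)ᵀ).mulVec w j) ^ 2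
      = (∑ i : {i // i ∈ τ}, A i j * w i) ^ 2 := rfl
    _ ≤ (∑ i : {i // i ∈ τ}, A i j ^ 2) * ∑ i, w i ^ 2 :=
        Finset.sum_mul_sq_le_sq_mul_sq _ _ _
    _ ≤ (∑ i, A i j ^ 2) * ∑ i, w i ^ 2 := by
        refine mul_le_mul_of_nonneg_right ?_ (Finset.sum_nonneg fun i _ => sq_nonneg _)
        rw [Finset.sum_coe_sort τ fun i => A i j ^ 2]
        exact Finset.sum_le_univ_sum_of_nonneg fun i => sq_nonneg _

lemma one_div_le_sup'_sq_div_sum_sq {m : ℕ} [NeZero m] {y : Fin m → ℝ} (hy : y ≠ 0) :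
    1 / (m : ℝ) ≤
      (Finset.univ.sup' Finset.univ_nonempty fun i => y i ^ 2) / ∑ i, y i ^ 2 := by
  obtain ⟨i, hi⟩ := Function.ne_iff.mp hy
  have hsum : 0 < ∑ i, y i ^ 2 :=
    Finset.sum_pos' (fun i _ => sq_nonneg _) ⟨i, Finset.mem_univ i, sq_pos_of_ne_zero hi⟩
  have hm : (0 : ℝ) < m := Nat.cast_pos.mpr (NeZero.pos m)
  rw [div_le_div_iff₀ hm hsum, one_mul, mul_comm]
  simpa using Finset.sum_le_card_nsmul Finset.univ (fun i => y i ^ 2) _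
    fun i hi => Finset.le_sup' (fun i => y i ^ 2) hi

/-- Comparison of the convergence factors of NGABK and NRK:
`1 − ((1−2ξ)/(1+ξ²))·δₖ|τₖ|σ²min(f'(xₖ))/‖f'_{τₖ}(xₖ)‖₂²
   < 1 − ((1−2ξ)/(1+ξ)²)·σ²min(f'(xₖ))/(m‖f'(xₖ)‖_F²)`.
Here `σmin > 0` is characterized by `σmin²‖v‖₂² ≤ ‖f'(xₖ)v‖₂²` for all `v`, and the
spectral norm `σmaxτ = ‖f'_{τₖ}(xₖ)‖₂ > 0` is characterized as the largest singular
value of the row submatrix: `‖f'_{τₖ}(xₖ)ᵀw‖₂² ≤ σmaxτ²‖w‖₂²` for all `w`, with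
equality attained at some `w ≠ 0`. `‖f'(xₖ)‖_F²` is the Frobenius norm squared. -/
theorem NGABK_factor_lt_NRK_factor
    {n m : ℕ} [NeZero m]
    (f : (Fin n → ℝ) → (Fin m → ℝ))
    (J : (Fin n → ℝ) → Matrix (Fin m) (Fin n) ℝ)
    (hJ : ∀ x, HasFDerivAt f (LinearMap.toContinuousLinearMap (J x).mulVecLin) x)
    (ξ : ℝ) (hξ0 : 0 < ξ) (hξ : ξ < 1 / 2)
    (xk : Fin n → ℝ) (hfk : f xk ≠ 0) (hJk : J xk ≠ 0)
    (δk : ℝ)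
    (hδ : δk = (1 / 2) *
      ((Finset.univ.sup' Finset.univ_nonempty fun i => (f xk i) ^ 2) / (∑ i, (f xk i) ^ 2)
        + 1 / (m : ℝ)))
    (τk : Finset (Fin m))
    (hτ : τk = Finset.univ.filter fun i => δk * ∑ j, (f xk j) ^ 2 ≤ (f xk i) ^ 2)
    (σmin : ℝ) (hσminpos : 0 < σmin)
    (hσmin : ∀ v : Fin n → ℝ, σmin ^ 2 * ∑ j, (v j) ^ 2 ≤ ∑ i, ((J xk).mulVec v i) ^ 2)
    (σmaxτ : ℝ) (hσmaxpos : 0 < σmaxτ)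
    (hσmaxU : ∀ w : {i // i ∈ τk} → ℝ,
      ∑ j, ((((J xk).submatrix (Subtype.val : {i // i ∈ τk} → Fin m) id)ᵀ).mulVec w j) ^ 2
        ≤ σmaxτ ^ 2 * ∑ i, (w i) ^ 2)
    (hσmaxA : ∃ w : {i // i ∈ τk} → ℝ, w ≠ 0 ∧
      ∑ j, ((((J xk).submatrix (Subtype.val : {i // i ∈ τk} → Fin m) id)ᵀ).mulVec w j) ^ 2
        = σmaxτ ^ 2 * ∑ i, (w i) ^ 2) :
    1 - ((1 - 2 * ξ) / (1 + ξ ^ 2)) * (δk * (τk.card : ℝ) * σmin ^ 2) / σmaxτ ^ 2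
      < 1 - ((1 - 2 * ξ) / (1 + ξ) ^ 2) * σmin ^ 2
          / ((m : ℝ) * ∑ i, ∑ j, (J xk i j) ^ 2) := by
  have hm : (0 : ℝ) < m := Nat.cast_pos.mpr (NeZero.pos m)
  have hδm : 1 / (m : ℝ) ≤ δk := by
    have := one_div_le_sup'_sq_div_sum_sq hfk
    linarith
  obtain ⟨w, hw, hwA⟩ := hσmaxA
  obtain ⟨i, hi⟩ := Function.ne_iff.mp hw
  have hcard : (1 : ℝ) ≤ τk.card := by
    exact_mod_cast Finset.card_pos.mpr ⟨i.1, i.2⟩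
  have hwpos : 0 < ∑ i, w i ^ 2 :=
    Finset.sum_pos' (fun i _ => sq_nonneg _) ⟨i, Finset.mem_univ i, sq_pos_of_ne_zero hi⟩
  have hF : σmaxτ ^ 2 ≤ ∑ i, ∑ j, J xk i j ^ 2 :=
    le_of_mul_le_mul_right (hwA ▸ sum_sq_mulVec_transpose_submatrix_le (J xk) τk w) hwpos
  have hS : 0 < σmaxτ ^ 2 := by positivity
  have hξ' : 0 < 1 - 2 * ξ := by linarith
  have hcoef : (1 - 2 * ξ) / (1 + ξ) ^ 2 < (1 - 2 * ξ) / (1 + ξ ^ 2) :=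
    div_lt_div_of_pos_left hξ' (by positivity) (by nlinarith)
  have hδc : 1 / (m : ℝ) ≤ δk * τk.card :=
    hδm.trans (le_mul_of_one_le_right ((one_div_pos.mpr hm).le.trans hδm) hcard)
  refine sub_lt_sub_left ?_ 1
  calc (1 - 2 * ξ) / (1 + ξ) ^ 2 * σmin ^ 2 / (m * ∑ i, ∑ j, J xk i j ^ 2)
      ≤ (1 - 2 * ξ) / (1 + ξ) ^ 2 * σmin ^ 2 / (m * σmaxτ ^ 2) := by gcongr
    _ = (1 - 2 * ξ) / (1 + ξ) ^ 2 * (1 / m * σmin ^ 2) / σmaxτ ^ 2 := by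
        field_simp
    _ < (1 - 2 * ξ) / (1 + ξ ^ 2) * (1 / m * σmin ^ 2) / σmaxτ ^ 2 := by gcongr
    _ ≤ (1 - 2 * ξ) / (1 + ξ ^ 2) * (δk * τk.card * σmin ^ 2) / σmaxτ ^ 2 := by gcongr
end

section
/- (Key ratio bound in the NGABK analysis.) Let A ∈ ℝ^{m×n}, y ∈ ℝᵐ with y ≠ 0, δ > 0, and let τ ⊆ [m] be a nonempty index set such that |y_i|² ≥ δ ‖y‖₂² for every i ∈ τ. Set η = Σ_{i∈τ} (−y_i) e_i ∈ ℝᵐ and assume Aᵀη ≠ 0. Then |ηᵀ y|² / ‖Aᵀ η‖₂² ≥ δ |τ| ‖y‖₂² / σ_max²(A_τ), where A_τ is the row submatrix of A with rows indexed by τ and |τ| is the cardinality of τ. -/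
open Matrix

/-- Key ratio bound in the NGABK analysis: for `A ∈ ℝ^{m×n}`, `y ≠ 0`,
`δ > 0`, a nonempty `τ ⊆ [m]` with `|yᵢ|² ≥ δ‖y‖₂²` for all `i ∈ τ`, and
`η = ∑_{i∈τ}(−yᵢ)eᵢ` with `Aᵀη ≠ 0`, one has
`|ηᵀy|²/‖Aᵀη‖₂² ≥ δ|τ|‖y‖₂²/σ²max(A_τ)`, where `σmax(A_τ)` (the largest singular value
of the row submatrix `A_τ`) is characterized by `‖A_τᵀw‖₂² ≤ σmax²‖w‖₂²` for all `w`. -/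
theorem NGABK_key_ratio_bound
    {m n : ℕ}
    (A : Matrix (Fin m) (Fin n) ℝ)
    (y : Fin m → ℝ) (hy : y ≠ 0)
    (δ : ℝ) (hδ : 0 < δ)
    (τ : Finset (Fin m)) (hτne : τ.Nonempty)
    (hτ : ∀ i ∈ τ, δ * ∑ j, (y j) ^ 2 ≤ (y i) ^ 2)
    (η : Fin m → ℝ)
    (hη : η = fun i => if i ∈ τ then -(y i) else 0)
    (hATη : (Aᵀ).mulVec η ≠ 0)
    (σmax : ℝ)
    (hσmax : ∀ w : {i // i ∈ τ} → ℝ,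
      ∑ j, (((A.submatrix (Subtype.val : {i // i ∈ τ} → Fin m) id)ᵀ).mulVec w j) ^ 2
        ≤ σmax ^ 2 * ∑ i, (w i) ^ 2) :
    (∑ i, η i * y i) ^ 2 / ∑ j, ((Aᵀ).mulVec η j) ^ 2
      ≥ δ * (τ.card : ℝ) * (∑ i, (y i) ^ 2) / σmax ^ 2 := by
  have hηy : ∑ i, η i * y i = -∑ i ∈ τ, y i ^ 2 := by
    simp [hη, ite_mul, sq, Finset.sum_ite_mem]
  have hw : ∑ i : {i // i ∈ τ}, (-y i) ^ 2 = ∑ i ∈ τ, y i ^ 2 := by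
    simpa using Finset.sum_coe_sort τ fun i => y i ^ 2
  have hmul : ((A.submatrix (Subtype.val : {i // i ∈ τ} → Fin m) id)ᵀ).mulVec
      (fun i => -y i) = (Aᵀ).mulVec η := by
    ext j
    have h := Finset.sum_coe_sort τ fun i => A i j * -y i
    simpa [hη, mulVec, dotProduct, Finset.sum_ite_mem] using h
  have hle := hσmax fun i => -y i
  rw [hmul, hw] at hle
  have hpos : 0 < ∑ j, ((Aᵀ).mulVec η j) ^ 2 := by
    obtain ⟨j, hj⟩ := Function.ne_iff.mp hATη
    exact Finset.sum_pos' (fun _ _ => sq_nonneg _) ⟨j, Finset.mem_univ j, sq_pos_of_ne_zero hj⟩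
  have hsum : δ * (τ.card : ℝ) * ∑ i, y i ^ 2 ≤ ∑ i ∈ τ, y i ^ 2 := by
    have h := Finset.card_nsmul_le_sum τ (fun i => y i ^ 2) _ hτ
    rw [nsmul_eq_mul] at h
    linarith
  have hS : 0 ≤ ∑ i ∈ τ, y i ^ 2 := Finset.sum_nonneg fun _ _ => sq_nonneg _
  have hσ : 0 < σmax ^ 2 := pos_of_mul_pos_left (hpos.trans_le hle) hS
  rw [hηy, neg_sq, ge_iff_le, div_le_div_iff₀ hσ hpos]
  calc _ ≤ (∑ i ∈ τ, y i ^ 2) * (σmax ^ 2 * ∑ i ∈ τ, y i ^ 2) := by gcongr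
    _ = _ := by ring
end

section
/- (Key ratio bound in the MRNABK analysis.) Let A ∈ ℝ^{m×n}, y ∈ ℝᵐ with y ≠ 0, ϱ ∈ (0,1], and let τ ⊆ [m] be a nonempty index set such that |y_i|² ≥ ϱ · max_{j∈[m]} |y_j|² for every i ∈ τ. Set η = Σ_{i∈τ} (−y_i) e_i ∈ ℝᵐ and assume Aᵀη ≠ 0. Then |ηᵀ y|² / ‖Aᵀ η‖₂² ≥ ϱ |τ| ‖y‖₂² / ( m · σ_max²(A_τ) ), where A_τ is the row submatrix of A with rows indexed by τ and |τ| is the cardinality of τ. -/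
open Matrix

theorem Matrix.transpose_submatrix_val_mulVec {m n R : Type*} [Fintype m] [DecidableEq m]
    [NonUnitalNonAssocSemiring R] (A : Matrix m n R) (τ : Finset m) (v : m → R) :
    (A.submatrix (Subtype.val : {i // i ∈ τ} → m) id)ᵀ *ᵥ (fun i => v i)
      = Aᵀ *ᵥ fun i => if i ∈ τ then v i else 0 := by
  ext j
  simp only [mulVec, dotProduct, transpose_apply, submatrix_apply, id, mul_ite, mul_zero,
    Finset.sum_ite_mem, Finset.univ_inter]
  exact Finset.sum_coe_sort τ fun i => A i j * v i

/-- If every `f i` with `i ∈ τ` is at least `ϱ` times the maximum of `f`, then the average of `f`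
over `τ` is at least `ϱ` times its average over the whole type. -/
theorem Finset.mul_card_mul_sum_le_card_mul_sum_of_mul_sup_le {ι : Type*} [Fintype ι] [Nonempty ι]
    (f : ι → ℝ) {ϱ : ℝ} (hϱ : 0 ≤ ϱ) (τ : Finset ι)
    (hτ : ∀ i ∈ τ, ϱ * Finset.univ.sup' Finset.univ_nonempty f ≤ f i) :
    ϱ * (τ.card : ℝ) * ∑ i, f i ≤ (Fintype.card ι : ℝ) * ∑ i ∈ τ, f i := by
  set M := Finset.univ.sup' Finset.univ_nonempty f
  have hsum : ∑ i, f i ≤ Fintype.card ι * M := by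
    simpa using Finset.sum_le_card_nsmul Finset.univ f M fun i hi => Finset.le_sup' f hi
  have hsumτ : (τ.card : ℝ) * (ϱ * M) ≤ ∑ i ∈ τ, f i := by
    simpa using Finset.card_nsmul_le_sum τ f (ϱ * M) hτ
  calc ϱ * (τ.card : ℝ) * ∑ i, f i
      ≤ ϱ * (τ.card : ℝ) * (Fintype.card ι * M) := by gcongr
    _ = Fintype.card ι * ((τ.card : ℝ) * (ϱ * M)) := by ring
    _ ≤ Fintype.card ι * ∑ i ∈ τ, f i := by gcongr

/-- Key ratio bound in the MRNABK analysis: for `A ∈ ℝ^{m×n}`, `y ≠ 0`,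
`ϱ ∈ (0,1]`, a nonempty `τ ⊆ [m]` with `|yᵢ|² ≥ ϱ·max_j|y_j|²` for all `i ∈ τ`, and
`η = ∑_{i∈τ}(−yᵢ)eᵢ` with `Aᵀη ≠ 0`, one has
`|ηᵀy|²/‖Aᵀη‖₂² ≥ ϱ|τ|‖y‖₂²/(m·σ²max(A_τ))`, where `σmax(A_τ)` (the largest singular
value of the row submatrix `A_τ`) is characterized by `‖A_τᵀw‖₂² ≤ σmax²‖w‖₂²` for all `w`. -/
theorem MRNABK_key_ratio_bound
    {m n : ℕ} [NeZero m]
    (A : Matrix (Fin m) (Fin n) ℝ)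
    (y : Fin m → ℝ) (hy : y ≠ 0)
    (ϱ : ℝ) (hϱ0 : 0 < ϱ) (hϱ1 : ϱ ≤ 1)
    (τ : Finset (Fin m)) (hτne : τ.Nonempty)
    (hτ : ∀ i ∈ τ,
      ϱ * (Finset.univ.sup' Finset.univ_nonempty fun j => (y j) ^ 2) ≤ (y i) ^ 2)
    (η : Fin m → ℝ)
    (hη : η = fun i => if i ∈ τ then -(y i) else 0)
    (hATη : (Aᵀ).mulVec η ≠ 0)
    (σmax : ℝ)
    (hσmax : ∀ w : {i // i ∈ τ} → ℝ,
      ∑ j, (((A.submatrix (Subtype.val : {i // i ∈ τ} → Fin m) id)ᵀ).mulVec w j) ^ 2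
        ≤ σmax ^ 2 * ∑ i, (w i) ^ 2) :
    (∑ i, η i * y i) ^ 2 / ∑ j, ((Aᵀ).mulVec η j) ^ 2
      ≥ ϱ * (τ.card : ℝ) * (∑ i, (y i) ^ 2) / ((m : ℝ) * σmax ^ 2) := by
  have hAη : ∑ j, (Aᵀ.mulVec η j) ^ 2 ≤ σmax ^ 2 * ∑ i ∈ τ, y i ^ 2 := by
    have h := hσmax fun i => -y i
    rw [transpose_submatrix_val_mulVec A τ fun i => -y i, ← hη] at h
    simpa only [neg_sq, Finset.sum_coe_sort τ fun i => y i ^ 2] using h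
  have hηy : ∑ i, η i * y i = -∑ i ∈ τ, y i ^ 2 := by
    simp [hη, ite_mul, Finset.sum_ite_mem, sq]
  have hpos : 0 < ∑ j, (Aᵀ.mulVec η j) ^ 2 := by
    obtain ⟨j, hj⟩ := Function.ne_iff.mp hATη
    exact Finset.sum_pos' (fun _ _ => sq_nonneg _) ⟨j, Finset.mem_univ j, sq_pos_of_ne_zero hj⟩
  have havg := Finset.mul_card_mul_sum_le_card_mul_sum_of_mul_sup_le
    (fun i => y i ^ 2) hϱ0.le τ hτ
  rw [Fintype.card_fin] at havg
  have hσ : 0 < σmax ^ 2 :=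
    pos_of_mul_pos_left (hpos.trans_le hAη) (Finset.sum_nonneg fun _ _ => sq_nonneg _)
  have hm : (0 : ℝ) < m := by exact_mod_cast NeZero.pos m
  rw [ge_iff_le, hηy, neg_sq, div_le_div_iff₀ (by positivity) hpos]
  calc ϱ * (τ.card : ℝ) * (∑ i, y i ^ 2) * ∑ j, (Aᵀ.mulVec η j) ^ 2
      ≤ (m * ∑ i ∈ τ, y i ^ 2) * (σmax ^ 2 * ∑ i ∈ τ, y i ^ 2) := by gcongr
    _ = (∑ i ∈ τ, y i ^ 2) ^ 2 * (m * σmax ^ 2) := by ring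
end
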